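/- arXiv:1507.00684 — 6 statements merged into one kernel-verified Lean document; each statement's English description precedes it below -/
import Mathlib

section
/- Let G be a group, H a subgroup of index 2, c̃ ∈ G \ H, E a field, V a finite-dimensional E-vector space, ρ : H → GL(V) a representation, and ε ∈ {+1, −1}. Then there is a unique group homomorphism As^ε(ρ) : G → GL(V ⊗_E V) such that As^ε(ρ)(h)(x ⊗ y) = ρ(h)x ⊗ ρ(c̃hc̃⁻¹)y for all h ∈ H and x, y ∈ V, and As^ε(ρ)(c̃)(x ⊗ y) = ε·(y ⊗ ρ(c̃²)x) for all x, y ∈ V. -/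
open TensorProduct

/-- The conjugate of an element of a normal subgroup `H` by `c`, as an element of `H`. -/
def Subgroup.Normal.conjElt {G : Type*} [Group G] {H : Subgroup G} (hN : H.Normal)
    (c : G) (h : H) : H :=
  ⟨c * h * c⁻¹, hN.conj_mem h h.2 c⟩

/-- Extension of `ρ` to all of `G` by zero. -/
noncomputable def asaiExt {G : Type*} [Group G] {H : Subgroup G}
    {E V : Type*} [Field E] [AddCommGroup V] [Module E V]
    (ρ : H →* (V →ₗ[E] V)ˣ) (g : G) : V →ₗ[E] V :=
  open Classical in if h : g ∈ H then (ρ ⟨g, h⟩ : V →ₗ[E] V) else 0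

theorem asaiExt_mem {G : Type*} [Group G] {H : Subgroup G}
    {E V : Type*} [Field E] [AddCommGroup V] [Module E V]
    (ρ : H →* (V →ₗ[E] V)ˣ) {g : G} (h : g ∈ H) :
    asaiExt ρ g = (ρ ⟨g, h⟩ : V →ₗ[E] V) := by
  simp [asaiExt, h]

theorem asaiExt_mul {G : Type*} [Group G] {H : Subgroup G}
    {E V : Type*} [Field E] [AddCommGroup V] [Module E V]
    (ρ : H →* (V →ₗ[E] V)ˣ) {a b k : G} (ha : a ∈ H) (hb : b ∈ H) (hk : a * b = k) (x : V) :
    asaiExt ρ a (asaiExt ρ b x) = asaiExt ρ k x := by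
  subst hk
  rw [asaiExt_mem ρ ha, asaiExt_mem ρ hb, asaiExt_mem ρ (H.mul_mem ha hb)]
  have : (⟨a * b, H.mul_mem ha hb⟩ : H) = ⟨a, ha⟩ * ⟨b, hb⟩ := rfl
  rw [this, map_mul]
  rfl

/-- The underlying function of the Asai representation. -/
noncomputable def asaiFun {G : Type*} [Group G] {H : Subgroup G} (c : G)
    {E V : Type*} [Field E] [AddCommGroup V] [Module E V]
    (ρ : H →* (V →ₗ[E] V)ˣ) (ε : E) (g : G) : V ⊗[E] V →ₗ[E] V ⊗[E] V :=
  open Classical in if g ∈ H then TensorProduct.map (asaiExt ρ g) (asaiExt ρ (c * g * c⁻¹))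
  else ε • ((TensorProduct.comm E V V).toLinearMap ∘ₗ
    TensorProduct.map (asaiExt ρ (c * g)) (asaiExt ρ (g * c⁻¹)))

theorem asaiFun_mem {G : Type*} [Group G] {H : Subgroup G} (c : G)
    {E V : Type*} [Field E] [AddCommGroup V] [Module E V]
    (ρ : H →* (V →ₗ[E] V)ˣ) (ε : E) {g : G} (hg : g ∈ H) (x y : V) :
    asaiFun c ρ ε g (x ⊗ₜ[E] y) = asaiExt ρ g x ⊗ₜ[E] asaiExt ρ (c * g * c⁻¹) y := by
  simp [asaiFun, hg]

theorem asaiFun_not_mem {G : Type*} [Group G] {H : Subgroup G} (c : G)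
    {E V : Type*} [Field E] [AddCommGroup V] [Module E V]
    (ρ : H →* (V →ₗ[E] V)ˣ) (ε : E) {g : G} (hg : g ∉ H) (x y : V) :
    asaiFun c ρ ε g (x ⊗ₜ[E] y) = ε • (asaiExt ρ (g * c⁻¹) y ⊗ₜ[E] asaiExt ρ (c * g) x) := by
  simp [asaiFun, hg]

/-- **Existence and uniqueness of the Asai (tensor induction) representation.**
Let `G` be a group, `H` a subgroup of index 2 (hence normal), `c ∉ H`, `E` a field, `V` a
finite-dimensional `E`-vector space, `ρ : H → GL(V)` a representation and `ε ∈ {1, -1}`.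
Then there is a unique homomorphism `A : G → GL(V ⊗ V)` with
`A h (x ⊗ y) = ρ h x ⊗ ρ (c h c⁻¹) y` for `h ∈ H` and `A c (x ⊗ y) = ε • (y ⊗ ρ (c²) x)`. -/
theorem asai_exists_unique {G : Type*} [Group G] {H : Subgroup G}
    (hH : H.index = 2) (hN : H.Normal) {c : G} (hc : c ∉ H)
    {E V : Type*} [Field E] [AddCommGroup V] [Module E V] [FiniteDimensional E V]
    (ρ : H →* (V →ₗ[E] V)ˣ) (ε : E) (hε : ε = 1 ∨ ε = -1) :
    ∃! A : G →* (V ⊗[E] V →ₗ[E] V ⊗[E] V)ˣ,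
      (∀ (h : H) (x y : V),
        (A h : V ⊗[E] V →ₗ[E] V ⊗[E] V) (x ⊗ₜ[E] y)
          = ((ρ h : V →ₗ[E] V) x) ⊗ₜ[E] ((ρ (hN.conjElt c h) : V →ₗ[E] V) y)) ∧
      (∀ x y : V,
        (A c : V ⊗[E] V →ₗ[E] V ⊗[E] V) (x ⊗ₜ[E] y)
          = ε • (y ⊗ₜ[E] ((ρ ⟨c * c, Subgroup.mul_self_mem_of_index_two hH c⟩ : V →ₗ[E] V) x))) := by
  have hm : ∀ {a b : G}, a * b ∈ H ↔ (a ∈ H ↔ b ∈ H) := Subgroup.mul_mem_iff_of_index_two hH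
  have hci : c⁻¹ ∉ H := by simpa using hc
  have hεε : ε * ε = 1 := by rcases hε with rfl | rfl <;> simp
  have hone : asaiExt ρ (1 : G) = LinearMap.id := by
    rw [asaiExt_mem ρ H.one_mem]
    have : (⟨1, H.one_mem⟩ : H) = 1 := rfl
    rw [this, map_one]
    rfl
  let F : G →* (V ⊗[E] V →ₗ[E] V ⊗[E] V) :=
    { toFun := asaiFun c ρ ε
      map_one' := by
        refine TensorProduct.ext' fun x y => ?_
        rw [asaiFun_mem c ρ ε H.one_mem]
        simp [hone]
      map_mul' := by
        intro g h
        refine TensorProduct.ext' fun x y => ?_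
        rw [Module.End.mul_apply]
        by_cases hg : g ∈ H <;> by_cases hh : h ∈ H
        · have hgh : g * h ∈ H := by simp [hm, hg, hh]
          rw [asaiFun_mem c ρ ε hgh, asaiFun_mem c ρ ε hh, asaiFun_mem c ρ ε hg,
            asaiExt_mul ρ (k := g * h) hg hh rfl,
            asaiExt_mul ρ (k := c * (g * h) * c⁻¹) (by simp [*]) (by simp [*]) (by group)]
        · have hgh : g * h ∉ H := by simp [hm, hg, hh]
          rw [asaiFun_not_mem c ρ ε hgh, asaiFun_not_mem c ρ ε hh, map_smul, asaiFun_mem c ρ ε hg,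
            asaiExt_mul ρ (k := g * h * c⁻¹) hg (by simp [*]) (by group),
            asaiExt_mul ρ (k := c * (g * h)) (by simp [*]) (by simp [*]) (by group)]
        · have hgh : g * h ∉ H := by simp [hm, hg, hh]
          rw [asaiFun_not_mem c ρ ε hgh, asaiFun_mem c ρ ε hh, asaiFun_not_mem c ρ ε hg,
            asaiExt_mul ρ (k := g * h * c⁻¹) (by simp [*]) (by simp [*]) (by group),
            asaiExt_mul ρ (k := c * (g * h)) (by simp [*]) hh (by group)]
        · have hgh : g * h ∈ H := by simp [hm, hg, hh]
          rw [asaiFun_mem c ρ ε hgh, asaiFun_not_mem c ρ ε hh, map_smul,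
            asaiFun_not_mem c ρ ε hg, smul_smul, hεε, one_smul,
            asaiExt_mul ρ (k := g * h) (by simp [*]) (by simp [*]) (by group),
            asaiExt_mul ρ (k := c * (g * h) * c⁻¹) (by simp [*]) (by simp [*])
              (by group)] }
  refine ⟨F.toHomUnits, ⟨?_, ?_⟩, ?_⟩
  · intro h x y
    change asaiFun c ρ ε (h : G) (x ⊗ₜ[E] y) = _
    rw [asaiFun_mem c ρ ε h.2, asaiExt_mem ρ h.2, asaiExt_mem ρ (hN.conj_mem h h.2 c)]
    rfl
  · intro x y
    change asaiFun c ρ ε c (x ⊗ₜ[E] y) = _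
    rw [asaiFun_not_mem c ρ ε hc, mul_inv_cancel, hone,
      asaiExt_mem ρ (Subgroup.mul_self_mem_of_index_two hH c)]
    rfl
  · rintro B ⟨hB1, hB2⟩
    have h1 : ∀ g ∈ H, B g = F.toHomUnits g := by
      intro g hg
      refine Units.ext (TensorProduct.ext' fun x y => ?_)
      change _ = asaiFun c ρ ε g (x ⊗ₜ[E] y)
      rw [hB1 ⟨g, hg⟩, asaiFun_mem c ρ ε hg, asaiExt_mem ρ hg,
        asaiExt_mem ρ (hN.conj_mem g hg c)]
      rfl
    have h2 : B c = F.toHomUnits c := by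
      refine Units.ext (TensorProduct.ext' fun x y => ?_)
      change _ = asaiFun c ρ ε c (x ⊗ₜ[E] y)
      rw [hB2, asaiFun_not_mem c ρ ε hc, mul_inv_cancel, hone,
        asaiExt_mem ρ (Subgroup.mul_self_mem_of_index_two hH c)]
      rfl
    refine MonoidHom.ext fun g => ?_
    by_cases hg : g ∈ H
    · exact h1 g hg
    · have hgc : g * c⁻¹ ∈ H := by simp [*]
      have e : g = g * c⁻¹ * c := by group
      rw [e, map_mul B (g * c⁻¹) c, map_mul F.toHomUnits (g * c⁻¹) c, h1 _ hgc, h2]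
end

section
/- (Prasad) For representations ρ₁ : H → GL(V₁) and ρ₂ : H → GL(V₂) on finite-dimensional E-vector spaces, the canonical E-linear isomorphism (V₁ ⊗ V₂) ⊗ (V₁ ⊗ V₂) ≅ (V₁ ⊗ V₁) ⊗ (V₂ ⊗ V₂) rearranging the tensor factors intertwines the G-representations As^+(ρ₁ ⊗ ρ₂) and As^+(ρ₁) ⊗ As^+(ρ₂); in particular As^+(ρ₁ ⊗ ρ₂) ≅ As^+(ρ₁) ⊗ As^+(ρ₂) as representations of G. -/
open TensorProduct

/-- `IsAsai hN hH c ρ ε A` says that `A : G → GL(V ⊗ V)` is the Asai (tensor induction)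
representation `Asᵉ(ρ)` of `ρ : H → GL(V)` with respect to the lift `c` of the nontrivial
element of `G/H`: it satisfies `A h (x ⊗ y) = ρ h x ⊗ ρ(c h c⁻¹) y` for `h ∈ H` and
`A c (x ⊗ y) = ε • (y ⊗ ρ(c²) x)`.  (These properties determine `A` uniquely.) -/
def IsAsai {G : Type*} [Group G] {H : Subgroup G} (hN : H.Normal) (hH : H.index = 2)
    {E V : Type*} [Field E] [AddCommGroup V] [Module E V]
    (c : G) (ρ : H →* (V →ₗ[E] V)ˣ) (ε : E)
    (A : G →* (V ⊗[E] V →ₗ[E] V ⊗[E] V)ˣ) : Prop :=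
  (∀ (h : H) (x y : V),
      (A h : V ⊗[E] V →ₗ[E] V ⊗[E] V) (x ⊗ₜ[E] y)
        = ((ρ h : V →ₗ[E] V) x) ⊗ₜ[E] ((ρ (hN.conjElt c h) : V →ₗ[E] V) y)) ∧
  (∀ x y : V,
      (A c : V ⊗[E] V →ₗ[E] V ⊗[E] V) (x ⊗ₜ[E] y)
        = ε • (y ⊗ₜ[E] ((ρ ⟨c * c, Subgroup.mul_self_mem_of_index_two hH c⟩ : V →ₗ[E] V) x)))

/-- **(Prasad) `As⁺` is multiplicative in tensor products.**
For representations `ρ₁ : H → GL(V₁)` and `ρ₂ : H → GL(V₂)`, the canonical rearrangement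
isomorphism `(V₁ ⊗ V₂) ⊗ (V₁ ⊗ V₂) ≅ (V₁ ⊗ V₁) ⊗ (V₂ ⊗ V₂)` intertwines the
`G`-representations `As⁺(ρ₁ ⊗ ρ₂)` and `As⁺(ρ₁) ⊗ As⁺(ρ₂)`; in particular
`As⁺(ρ₁ ⊗ ρ₂) ≅ As⁺(ρ₁) ⊗ As⁺(ρ₂)`.  Here `σ` is the tensor product representation
`ρ₁ ⊗ ρ₂` of `H` on `V₁ ⊗ V₂` and `T` the tensor product `G`-representation
`As⁺(ρ₁) ⊗ As⁺(ρ₂)` on `(V₁ ⊗ V₁) ⊗ (V₂ ⊗ V₂)`. -/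
theorem asai_plus_tensor {G : Type*} [Group G] {H : Subgroup G}
    (hH : H.index = 2) (hN : H.Normal) {c : G} (hc : c ∉ H)
    {E V₁ V₂ : Type*} [Field E] [AddCommGroup V₁] [Module E V₁] [FiniteDimensional E V₁]
    [AddCommGroup V₂] [Module E V₂] [FiniteDimensional E V₂]
    (ρ₁ : H →* (V₁ →ₗ[E] V₁)ˣ) (ρ₂ : H →* (V₂ →ₗ[E] V₂)ˣ)
    (σ : H →* (V₁ ⊗[E] V₂ →ₗ[E] V₁ ⊗[E] V₂)ˣ)
    (hσ : ∀ (h : H) (x : V₁) (y : V₂),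
      (σ h : V₁ ⊗[E] V₂ →ₗ[E] V₁ ⊗[E] V₂) (x ⊗ₜ[E] y)
        = ((ρ₁ h : V₁ →ₗ[E] V₁) x) ⊗ₜ[E] ((ρ₂ h : V₂ →ₗ[E] V₂) y))
    (A₁₂ : G →* ((V₁ ⊗[E] V₂) ⊗[E] (V₁ ⊗[E] V₂) →ₗ[E] (V₁ ⊗[E] V₂) ⊗[E] (V₁ ⊗[E] V₂))ˣ)
    (A₁ : G →* (V₁ ⊗[E] V₁ →ₗ[E] V₁ ⊗[E] V₁)ˣ)
    (A₂ : G →* (V₂ ⊗[E] V₂ →ₗ[E] V₂ ⊗[E] V₂)ˣ)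
    (hA₁₂ : IsAsai hN hH c σ (1 : E) A₁₂)
    (hA₁ : IsAsai hN hH c ρ₁ (1 : E) A₁) (hA₂ : IsAsai hN hH c ρ₂ (1 : E) A₂)
    (T : G →* ((V₁ ⊗[E] V₁) ⊗[E] (V₂ ⊗[E] V₂) →ₗ[E] (V₁ ⊗[E] V₁) ⊗[E] (V₂ ⊗[E] V₂))ˣ)
    (hT : ∀ (g : G) (a : V₁ ⊗[E] V₁) (b : V₂ ⊗[E] V₂),
      (T g : (V₁ ⊗[E] V₁) ⊗[E] (V₂ ⊗[E] V₂) →ₗ[E] (V₁ ⊗[E] V₁) ⊗[E] (V₂ ⊗[E] V₂)) (a ⊗ₜ[E] b)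
        = ((A₁ g : V₁ ⊗[E] V₁ →ₗ[E] V₁ ⊗[E] V₁) a) ⊗ₜ[E]
            ((A₂ g : V₂ ⊗[E] V₂ →ₗ[E] V₂ ⊗[E] V₂) b)) :
    ∀ (g : G) (z : (V₁ ⊗[E] V₂) ⊗[E] (V₁ ⊗[E] V₂)),
      (TensorProduct.tensorTensorTensorComm E V₁ V₂ V₁ V₂)
          ((A₁₂ g : (V₁ ⊗[E] V₂) ⊗[E] (V₁ ⊗[E] V₂) →ₗ[E] (V₁ ⊗[E] V₂) ⊗[E] (V₁ ⊗[E] V₂)) z)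
        = (T g : (V₁ ⊗[E] V₁) ⊗[E] (V₂ ⊗[E] V₂) →ₗ[E] (V₁ ⊗[E] V₁) ⊗[E] (V₂ ⊗[E] V₂))
            ((TensorProduct.tensorTensorTensorComm E V₁ V₂ V₁ V₂) z) := by
  have ext4 : ∀ (f k : (V₁ ⊗[E] V₂) ⊗[E] (V₁ ⊗[E] V₂) →ₗ[E] (V₁ ⊗[E] V₁) ⊗[E] (V₂ ⊗[E] V₂)),
      (∀ x y u w, f ((x ⊗ₜ[E] y) ⊗ₜ[E] (u ⊗ₜ[E] w)) = k ((x ⊗ₜ[E] y) ⊗ₜ[E] (u ⊗ₜ[E] w)))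
      → ∀ z, f z = k z := by
    intro f k hfk z
    induction z using TensorProduct.induction_on with
    | zero => simp
    | add a b ha hb => rw [map_add, map_add, ha, hb]
    | tmul a b =>
      induction a using TensorProduct.induction_on with
      | zero => simp
      | add a d ha hb => rw [TensorProduct.add_tmul, map_add, map_add, ha, hb]
      | tmul x y =>
        induction b using TensorProduct.induction_on with
        | zero => simp
        | add a d ha hb => rw [TensorProduct.tmul_add, map_add, map_add, ha, hb]
        | tmul u w => exact hfk x y u w
  have key_h : ∀ (h : H) z, (TensorProduct.tensorTensorTensorComm E V₁ V₂ V₁ V₂)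
      ((A₁₂ h).val z) = (T h).val ((TensorProduct.tensorTensorTensorComm E V₁ V₂ V₁ V₂) z) := by
    intro h
    refine ext4 ((TensorProduct.tensorTensorTensorComm E V₁ V₂ V₁ V₂).toLinearMap ∘ₗ (A₁₂ h).val)
      ((T h).val ∘ₗ (TensorProduct.tensorTensorTensorComm E V₁ V₂ V₁ V₂).toLinearMap) ?_
    intro x y u w
    simp only [LinearMap.comp_apply, LinearEquiv.coe_coe,
      TensorProduct.tensorTensorTensorComm_tmul, hT, hA₁.1, hA₂.1, hA₁₂.1, hσ]
  have key_c : ∀ z, (TensorProduct.tensorTensorTensorComm E V₁ V₂ V₁ V₂)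
      ((A₁₂ c).val z) = (T c).val ((TensorProduct.tensorTensorTensorComm E V₁ V₂ V₁ V₂) z) := by
    refine ext4 ((TensorProduct.tensorTensorTensorComm E V₁ V₂ V₁ V₂).toLinearMap ∘ₗ (A₁₂ c).val)
      ((T c).val ∘ₗ (TensorProduct.tensorTensorTensorComm E V₁ V₂ V₁ V₂).toLinearMap) ?_
    intro x y u w
    simp only [LinearMap.comp_apply, LinearEquiv.coe_coe, one_smul,
      TensorProduct.tensorTensorTensorComm_tmul, hT, hA₁.2, hA₂.2, hA₁₂.2, hσ]
  intro g z
  by_cases hg : g ∈ H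
  · exact key_h ⟨g, hg⟩ z
  · have hm : g * c ∈ H := (Subgroup.mul_mem_iff_of_index_two hH).2 (by tauto)
    have hcc : c * c ∈ H := Subgroup.mul_self_mem_of_index_two hH c
    have hmem : g * c * (c * c)⁻¹ ∈ H := H.mul_mem hm (H.inv_mem hcc)
    have hgc : g = g * c * (c * c)⁻¹ * c := by group
    have e := key_h ⟨_, hmem⟩ ((A₁₂ c).val z)
    rw [key_c] at e
    rw [hgc, map_mul A₁₂, map_mul T, Units.val_mul, Units.val_mul]
    exact e
end

section
/- (Prasad) For a representation ρ : H → GL(V) on a finite-dimensional E-vector space and ε ∈ {+1, −1}, the canonical E-linear isomorphism V^∨ ⊗ V^∨ ≅ (V ⊗ V)^∨ intertwines the G-representations As^ε(ρ^∨) and (As^ε(ρ))^∨; in particular As^ε(ρ^∨) ≅ As^ε(ρ)^∨ as representations of G. -/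
open TensorProduct

/-- **(Prasad) `As` commutes with duals.**
For a representation `ρ : H → GL(V)` and `ε ∈ {1, -1}`, the canonical isomorphism
`V^∨ ⊗ V^∨ ≅ (V ⊗ V)^∨` intertwines the `G`-representations `Asᵉ(ρ^∨)` and `(Asᵉ(ρ))^∨`;
in particular `Asᵉ(ρ^∨) ≅ Asᵉ(ρ)^∨`.  Here `ρd` is the contragredient of `ρ`, `A` is
`Asᵉ(ρ)`, `Ad` the contragredient of `A`, and `Adual` is `Asᵉ(ρ^∨)`. -/
theorem asai_dual {G : Type*} [Group G] {H : Subgroup G}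
    (hH : H.index = 2) (hN : H.Normal) {c : G} (hc : c ∉ H)
    {E V : Type*} [Field E] [AddCommGroup V] [Module E V] [FiniteDimensional E V]
    (ρ : H →* (V →ₗ[E] V)ˣ) (ε : E) (hε : ε = 1 ∨ ε = -1)
    (ρd : H →* (Module.Dual E V →ₗ[E] Module.Dual E V)ˣ)
    (hρd : ∀ (h : H) (f : Module.Dual E V) (v : V),
      ((ρd h : Module.Dual E V →ₗ[E] Module.Dual E V) f) v
        = f ((((ρ h)⁻¹ : (V →ₗ[E] V)ˣ) : V →ₗ[E] V) v))
    (A : G →* (V ⊗[E] V →ₗ[E] V ⊗[E] V)ˣ) (hA : IsAsai hN hH c ρ ε A)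
    (Ad : G →* (Module.Dual E (V ⊗[E] V) →ₗ[E] Module.Dual E (V ⊗[E] V))ˣ)
    (hAd : ∀ (g : G) (f : Module.Dual E (V ⊗[E] V)) (w : V ⊗[E] V),
      ((Ad g : Module.Dual E (V ⊗[E] V) →ₗ[E] Module.Dual E (V ⊗[E] V)) f) w
        = f ((((A g)⁻¹ : (V ⊗[E] V →ₗ[E] V ⊗[E] V)ˣ) : V ⊗[E] V →ₗ[E] V ⊗[E] V) w))
    (Adual : G →* (Module.Dual E V ⊗[E] Module.Dual E V →ₗ[E]
        Module.Dual E V ⊗[E] Module.Dual E V)ˣ)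
    (hAdual : IsAsai hN hH c ρd ε Adual) :
    ∀ (g : G) (z : Module.Dual E V ⊗[E] Module.Dual E V),
      (TensorProduct.dualDistribEquiv E V V)
          ((Adual g : Module.Dual E V ⊗[E] Module.Dual E V →ₗ[E]
              Module.Dual E V ⊗[E] Module.Dual E V) z)
        = (Ad g : Module.Dual E (V ⊗[E] V) →ₗ[E] Module.Dual E (V ⊗[E] V))
            ((TensorProduct.dualDistribEquiv E V V) z) := by
  have hD : ∀ (f g : Module.Dual E V) (x y : V),
      (TensorProduct.dualDistribEquiv E V V) (f ⊗ₜ[E] g) (x ⊗ₜ[E] y) = f x * g y := by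
    intro f g x y
    exact TensorProduct.dualDistrib_apply f g x y
  have hpair : ∀ (h : H) (f : Module.Dual E V) (v : V),
      ((ρd h : Module.Dual E V →ₗ[E] Module.Dual E V) f) ((ρ h : V →ₗ[E] V) v) = f v := by
    intro h f v
    rw [hρd, ← Module.End.mul_apply, Units.inv_mul, Module.End.one_apply]
  have hεε : ε * ε = 1 := by
    rcases hε with rfl | rfl <;> simp
  -- it suffices to check invariance of the pairing on pure tensors
  have ext : ∀ g : G, (∀ (p q : Module.Dual E V) (x y : V),
      (TensorProduct.dualDistribEquiv E V V)
        ((Adual g : Module.Dual E V ⊗[E] Module.Dual E V →ₗ[E]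
              Module.Dual E V ⊗[E] Module.Dual E V) (p ⊗ₜ[E] q))
        ((A g : V ⊗[E] V →ₗ[E] V ⊗[E] V) (x ⊗ₜ[E] y)) = p x * q y) →
      ∀ z w, (TensorProduct.dualDistribEquiv E V V)
        ((Adual g : Module.Dual E V ⊗[E] Module.Dual E V →ₗ[E]
              Module.Dual E V ⊗[E] Module.Dual E V) z)
        ((A g : V ⊗[E] V →ₗ[E] V ⊗[E] V) w) = (TensorProduct.dualDistribEquiv E V V) z w := by
    intro g hg z w
    induction z using TensorProduct.induction_on with
    | zero => simp only [map_zero, LinearMap.zero_apply]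
    | add a b ha hb => simp only [map_add, LinearMap.add_apply, ha, hb]
    | tmul p q =>
      induction w using TensorProduct.induction_on with
      | zero => simp only [map_zero]
      | add a b ha hb => simp only [map_add, ha, hb]
      | tmul x y => rw [hg, hD]
  have key : ∀ (g : G) z w, (TensorProduct.dualDistribEquiv E V V)
        ((Adual g : Module.Dual E V ⊗[E] Module.Dual E V →ₗ[E]
              Module.Dual E V ⊗[E] Module.Dual E V) z)
        ((A g : V ⊗[E] V →ₗ[E] V ⊗[E] V) w) = (TensorProduct.dualDistribEquiv E V V) z w := by
    have keyH := fun h : H => ext h (fun p q x y => by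
      rw [hA.1, hAdual.1, hD, hpair, hpair])
    have keyc := ext c (fun p q x y => by
      rw [hA.2, hAdual.2, map_smul, map_smul, LinearMap.smul_apply, hD, hpair,
        smul_smul, hεε, one_smul, mul_comm])
    intro g z w
    by_cases hg : g ∈ H
    · exact keyH ⟨g, hg⟩ z w
    · have hm : g * c⁻¹ ∈ H := by
        rw [Subgroup.mul_mem_iff_of_index_two hH, H.inv_mem_iff]
        exact iff_of_false hg hc
      have e : g = (g * c⁻¹) * c := by group
      rw [e, map_mul Adual (g * c⁻¹) c, map_mul A (g * c⁻¹) c, Units.val_mul, Units.val_mul,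
        Module.End.mul_apply, Module.End.mul_apply]
      exact (keyH ⟨g * c⁻¹, hm⟩ _ _).trans (keyc z w)
  intro g z
  refine LinearMap.ext fun w => ?_
  rw [hAd, ← key g z, ← Module.End.mul_apply, Units.mul_inv, Module.End.one_apply]
end

section
/- (Prasad) Let χ : H → Eˣ be a homomorphism, regarded as a one-dimensional representation of H. Then As^+(χ) : G → Eˣ is equal to the composition of χ with the transfer homomorphism Ver : G → H^{ab} associated to the index-2 subgroup H of G; concretely, As^+(χ)(g) = χ(g)·χ(c̃gc̃⁻¹) for g ∈ H and As^+(χ)(g) = χ(c̃⁻¹g²c̃) for g ∉ H. -/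
open Classical in
/-- The transversal function of an index two subgroup. -/
noncomputable def asaiRep {G : Type*} [Group G] (H : Subgroup G) (c : G) : G ⧸ H → G :=
  fun q => if q = ((1 : G) : G ⧸ H) then 1 else c⁻¹

theorem asai_transfer_eq {G : Type*} [Group G] {H : Subgroup G} [H.FiniteIndex]
    (hH : H.index = 2) {c : G} (hc : c ∉ H) {M : Type*} [CommGroup M] (χ : H →* M)
    (g : G) (a b : H)
    (ha : (a : G) = g * asaiRep H c ((g⁻¹ : G) : G ⧸ H))
    (hb : (b : G) = c * g * asaiRep H c ((g⁻¹ * c⁻¹ : G) : G ⧸ H)) :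
    MonoidHom.transfer χ g = χ a * χ b := by
  classical
  have h1c : ((1 : G) : G ⧸ H) ≠ ((c⁻¹ : G) : G ⧸ H) := by
    rw [Ne, QuotientGroup.eq]; simpa using hc
  have hcase : ∀ q : G ⧸ H, q = ((1 : G) : G ⧸ H) ∨ q = ((c⁻¹ : G) : G ⧸ H) := by
    intro q
    induction q using QuotientGroup.induction_on with
    | H x =>
      by_cases hx : x ∈ H
      · left; rw [QuotientGroup.eq]; simpa using hx
      · right; rw [QuotientGroup.eq, Subgroup.mul_mem_iff_of_index_two hH]; simp [hx, hc]
  have hf : ∀ q : G ⧸ H, ((asaiRep H c q : G) : G ⧸ H) = q := by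
    intro q
    rcases hcase q with rfl | rfl
    · simp [asaiRep]
    · rw [asaiRep, if_neg h1c.symm]
  let T : H.LeftTransversal := ⟨Set.range (asaiRep H c), Subgroup.isComplement_range_left hf⟩
  have hT : ∀ q, (T.2.leftQuotientEquiv q : G) = asaiRep H c q := fun q =>
    Subgroup.IsComplement.leftQuotientEquiv_apply hf q
  let _ := H.fintypeQuotientOfFiniteIndex
  have huniv : (Finset.univ : Finset (G ⧸ H)) = {((1 : G) : G ⧸ H), ((c⁻¹ : G) : G ⧸ H)} := by
    ext q; simpa using hcase q
  rw [MonoidHom.transfer_def χ T]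
  unfold Subgroup.leftTransversals.diff
  simp only
  rw [huniv, Finset.prod_pair h1c]
  congr 2
  · apply Subtype.ext
    rw [ha]
    simp only [Subgroup.smul_apply_eq_smul_apply_inv_smul, hT, smul_eq_mul,
      MulAction.Quotient.smul_coe, mul_one]
    simp [asaiRep]
  · apply Subtype.ext
    rw [hb]
    simp only [Subgroup.smul_apply_eq_smul_apply_inv_smul, hT, smul_eq_mul,
      MulAction.Quotient.smul_coe]
    rw [show asaiRep H c ((c⁻¹ : G) : G ⧸ H) = c⁻¹ by rw [asaiRep, if_neg h1c.symm]]
    simp [mul_assoc]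

/-- **(Prasad) `As⁺` of a character is the transfer.**
Let `χ : H → Eˣ` be a one-dimensional representation of the index-two subgroup `H ≤ G` and
let `A = As⁺(χ) : G → Eˣ` be the homomorphism with `A h = χ(h)·χ(c h c⁻¹)` for `h ∈ H` and
`A c = χ(c²)`.  Then `A` is the composition of `χ` with the transfer `Ver : G → H^{ab}`;
concretely, `A g = χ(g)·χ(c g c⁻¹)` for `g ∈ H` and `A g = χ(c⁻¹ g² c)` for `g ∉ H`. -/
theorem asai_plus_character_eq_transfer {G : Type*} [Group G] {H : Subgroup G}
    (hH : H.index = 2) (hN : H.Normal) {c : G} (hc : c ∉ H)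
    {E : Type*} [Field E] (χ : H →* Eˣ)
    (A : G →* Eˣ)
    (hA₁ : ∀ h : H, A h = χ h * χ (hN.conjElt c h))
    (hA₂ : A c = χ ⟨c * c, Subgroup.mul_self_mem_of_index_two hH c⟩) :
    (∀ (g : G) (hg : g ∈ H) (h₂ : H), (h₂ : G) = c * g * c⁻¹ →
        A g = χ ⟨g, hg⟩ * χ h₂) ∧
    (∀ (g : G), g ∉ H → ∀ h : H, (h : G) = c⁻¹ * (g * g) * c → A g = χ h) ∧
    A = @MonoidHom.transfer G _ H Eˣ _ χ ⟨by rw [hH]; exact two_ne_zero⟩ := by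
  have hfi : H.FiniteIndex := ⟨by rw [hH]; exact two_ne_zero⟩
  have hdec : ∀ g, g ∉ H → c⁻¹ * g ∈ H := by
    intro g hg
    rw [Subgroup.mul_mem_iff_of_index_two hH]; simp [hg, hc]
  refine ⟨?_, ?_, ?_⟩
  · intro g hg h₂ e
    have := hA₁ ⟨g, hg⟩
    rw [this]
    congr 2
    exact Subtype.ext e.symm
  · intro g hg h e
    have h1 := hA₁ ⟨c⁻¹ * g, hdec g hg⟩
    have h2 : A g = A c * A (c⁻¹ * g) := by rw [← map_mul]; simp
    rw [h2, hA₂, h1, mul_comm, ← map_mul, ← map_mul]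
    congr 1
    apply Subtype.ext
    rw [e]
    simp [Subgroup.Normal.conjElt, mul_assoc]
  · have hH' : ∀ h : G, h ∈ H → A h = MonoidHom.transfer χ h := by
      intro h hh
      rw [hA₁ ⟨h, hh⟩]
      symm
      apply asai_transfer_eq hH hc
      · have : ((h⁻¹ : G) : G ⧸ H) = ((1 : G) : G ⧸ H) := by
          rw [QuotientGroup.eq]; simpa using hh
        simp only [asaiRep, this, if_true, mul_one]
      · have : ((h⁻¹ * c⁻¹ : G) : G ⧸ H) ≠ ((1 : G) : G ⧸ H) := by
          rw [Ne, QuotientGroup.eq]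
          simp [Subgroup.mul_mem_iff_of_index_two hH, hh, hc]
        simp only [asaiRep, this, if_false, Subgroup.Normal.conjElt]
    have hC : A c = MonoidHom.transfer χ c := by
      rw [hA₂, asai_transfer_eq hH hc χ c 1 ⟨c * c, Subgroup.mul_self_mem_of_index_two hH c⟩,
        map_one, one_mul]
      · have : ((c⁻¹ : G) : G ⧸ H) ≠ ((1 : G) : G ⧸ H) := by
          rw [Ne, QuotientGroup.eq]; simpa using hc
        simp only [asaiRep, this, if_false]; simp
      · have : ((c⁻¹ * c⁻¹ : G) : G ⧸ H) = ((1 : G) : G ⧸ H) := by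
          rw [QuotientGroup.eq]
          simpa using Subgroup.mul_self_mem_of_index_two hH c
        simp only [asaiRep, this, if_true, mul_one]
    ext1 g
    by_cases hg : g ∈ H
    · exact hH' g hg
    · have h2 : g = c * (c⁻¹ * g) := by simp
      rw [h2, map_mul A c, map_mul (MonoidHom.transfer χ) c, hC, hH' _ (hdec g hg)]
end

section
/- Let ρ : H → GL₂(E) be a two-dimensional representation and η : G → Eˣ a homomorphism such that det(ρ(h)) = η(h) for all h ∈ H. Then for each ε ∈ {+1, −1} there is an isomorphism of G-representations As^ε(ρ)^∨ ≅ As^ε(ρ) ⊗ η^{−2}; equivalently, the G-representation As^ε(ρ) ⊗ η^{−1} is self-dual. -/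
open TensorProduct

theorem asaiAux_symp {E V : Type*} [Field E] [AddCommGroup V] [Module E V]
    [FiniteDimensional E V] (hV : Module.finrank E V = 2) :
    ∃ ω : V ≃ₗ[E] Module.Dual E V,
      ∀ (f : V →ₗ[E] V) (x y : V), ω (f x) (f y) = LinearMap.det f * ω x y := by
  let b : Module.Basis (Fin 2) E V := Module.finBasisOfFinrankEq E V hV
  let ω : V →ₗ[E] Module.Dual E V :=
    LinearMap.mk₂ E (fun x y => b.repr x 0 * b.repr y 1 - b.repr x 1 * b.repr y 0)
      (by intros; simp; ring) (by intros; simp; ring) (by intros; simp; ring)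
      (by intros; simp; ring)
  have hω : ∀ x y, ω x y = b.repr x 0 * b.repr y 1 - b.repr x 1 * b.repr y 0 :=
    fun x y => rfl
  have hd : ∀ x y, ω x y = b.det ![x, y] := by
    intro x y
    rw [hω, Module.Basis.det_apply, Matrix.det_fin_two]
    simp [Module.Basis.toMatrix_apply]
    ring
  have hinj : Function.Injective ω := by
    rw [injective_iff_map_eq_zero]
    intro x hx
    have h0 := hω x (b 0)
    have h1 := hω x (b 1)
    rw [hx] at h0 h1
    simp at h0 h1
    apply b.repr.injective
    ext i
    fin_cases i <;> simp [h0, h1]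
  refine ⟨LinearEquiv.ofInjectiveOfFinrankEq ω hinj
    Subspace.dual_finrank_eq.symm, fun f x y => ?_⟩
  change ω (f x) (f y) = LinearMap.det f * ω x y
  rw [hd, hd, ← Module.Basis.det_comp]
  congr 1
  ext i
  fin_cases i <;> rfl

/-- **Self-duality of the Asai representation of a two-dimensional representation up to
twist.**  If `ρ : H → GL(V)` is two-dimensional with `det ∘ ρ = η|_H` for a character
`η : G → Eˣ`, then for `ε ∈ {1, -1}` there is an isomorphism of `G`-representations
`Asᵉ(ρ)^∨ ≅ Asᵉ(ρ) ⊗ η⁻²`; equivalently `Asᵉ(ρ) ⊗ η⁻¹` is self-dual.  Here `A = Asᵉ(ρ)`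
and `Ad = Asᵉ(ρ)^∨` is its contragredient. -/
theorem asai_essentially_selfdual {G : Type*} [Group G] {H : Subgroup G}
    (hH : H.index = 2) (hN : H.Normal) {c : G} (hc : c ∉ H)
    {E V : Type*} [Field E] [AddCommGroup V] [Module E V] [FiniteDimensional E V]
    (hV : Module.finrank E V = 2)
    (ρ : H →* (V →ₗ[E] V)ˣ) (η : G →* Eˣ)
    (hdet : ∀ h : H, LinearMap.det (ρ h : V →ₗ[E] V) = (η h : E))
    (ε : E) (hε : ε = 1 ∨ ε = -1)
    (A : G →* (V ⊗[E] V →ₗ[E] V ⊗[E] V)ˣ) (hA : IsAsai hN hH c ρ ε A)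
    (Ad : G →* (Module.Dual E (V ⊗[E] V) →ₗ[E] Module.Dual E (V ⊗[E] V))ˣ)
    (hAd : ∀ (g : G) (f : Module.Dual E (V ⊗[E] V)) (w : V ⊗[E] V),
      ((Ad g : Module.Dual E (V ⊗[E] V) →ₗ[E] Module.Dual E (V ⊗[E] V)) f) w
        = f ((((A g)⁻¹ : (V ⊗[E] V →ₗ[E] V ⊗[E] V)ˣ) : V ⊗[E] V →ₗ[E] V ⊗[E] V) w)) :
    ∃ T : Module.Dual E (V ⊗[E] V) ≃ₗ[E] V ⊗[E] V,
      ∀ (g : G) (f : Module.Dual E (V ⊗[E] V)),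
        T ((Ad g : Module.Dual E (V ⊗[E] V) →ₗ[E] Module.Dual E (V ⊗[E] V)) f)
          = (((η g)⁻¹ ^ 2 : Eˣ) : E) •
              (A g : V ⊗[E] V →ₗ[E] V ⊗[E] V) (T f) := by
  obtain ⟨ω, hω⟩ := asaiAux_symp (E := E) hV
  let Φ : V ⊗[E] V ≃ₗ[E] Module.Dual E (V ⊗[E] V) :=
    (TensorProduct.congr ω ω).trans (TensorProduct.dualDistribEquiv E V V)
  have hΦ : ∀ x y x' y', Φ (x ⊗ₜ[E] y) (x' ⊗ₜ[E] y') = ω x x' * ω y y' := by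
    intro x y x' y'
    simp [Φ, TensorProduct.dualDistribEquiv, TensorProduct.dualDistribEquivOfBasis]
  -- it suffices to check invariance on pure tensors
  have key : ∀ (g : G), (∀ x y x' y' : V,
      Φ ((A g : V ⊗[E] V →ₗ[E] V ⊗[E] V) (x ⊗ₜ[E] y))
        ((A g : V ⊗[E] V →ₗ[E] V ⊗[E] V) (x' ⊗ₜ[E] y'))
        = (η g : E) ^ 2 * Φ (x ⊗ₜ[E] y) (x' ⊗ₜ[E] y')) →
      ∀ u v, Φ ((A g : V ⊗[E] V →ₗ[E] V ⊗[E] V) u)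
        ((A g : V ⊗[E] V →ₗ[E] V ⊗[E] V) v) = (η g : E) ^ 2 * Φ u v := by
    intro g hg u v
    induction u using TensorProduct.induction_on with
    | zero => simp
    | add a b ha hb => simp only [map_add, LinearMap.add_apply, ha, hb, mul_add]
    | tmul x y =>
      induction v using TensorProduct.induction_on with
      | zero => simp
      | add a b ha hb => simp only [map_add, ha, hb, mul_add]
      | tmul x' y' => exact hg x y x' y'
  have hε2 : ε * ε = 1 := by rcases hε with h | h <;> simp [h]
  have hHinv : ∀ (h : H) u v, Φ ((A h : V ⊗[E] V →ₗ[E] V ⊗[E] V) u)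
        ((A h : V ⊗[E] V →ₗ[E] V ⊗[E] V) v) = (η h : E) ^ 2 * Φ u v := by
    intro h
    refine key h fun x y x' y' => ?_
    have hcj : (η (hN.conjElt c h : H) : E) = η h := by
      simp [Subgroup.Normal.conjElt, mul_comm]
    rw [hA.1, hA.1, hΦ, hΦ, hω, hω, hdet, hdet, hcj]
    ring
  have hcinv : ∀ u v, Φ ((A c : V ⊗[E] V →ₗ[E] V ⊗[E] V) u)
        ((A c : V ⊗[E] V →ₗ[E] V ⊗[E] V) v) = (η c : E) ^ 2 * Φ u v := by
    refine key c fun x y x' y' => ?_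
    rw [hA.2, hA.2]
    simp only [map_smul, LinearMap.smul_apply, smul_eq_mul]
    rw [hΦ, hΦ, hω, hdet]
    simp only [map_mul, Units.val_mul]
    linear_combination ((η c : E) ^ 2 * ω x x' * ω y y') * hε2
  have hinv : ∀ (g : G) u v, Φ ((A g : V ⊗[E] V →ₗ[E] V ⊗[E] V) u)
        ((A g : V ⊗[E] V →ₗ[E] V ⊗[E] V) v) = (η g : E) ^ 2 * Φ u v := by
    intro g u v
    by_cases hg : g ∈ H
    · exact hHinv ⟨g, hg⟩ u v
    · have hm : g * c ∈ H := by
        rw [Subgroup.mul_mem_iff_of_index_two hH]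
        exact iff_of_false hg hc
      have hcc : (c * c) ∈ H := Subgroup.mul_self_mem_of_index_two hH c
      have hm' : g * c⁻¹ ∈ H := by
        have := H.mul_mem hm (H.inv_mem hcc)
        simpa [mul_assoc] using this
      have e : g = (g * c⁻¹) * c := by simp
      have h1 := hHinv ⟨g * c⁻¹, hm'⟩ ((A c : V ⊗[E] V →ₗ[E] V ⊗[E] V) u)
        ((A c : V ⊗[E] V →ₗ[E] V ⊗[E] V) v)
      rw [hcinv] at h1
      have h2 : (A g : V ⊗[E] V →ₗ[E] V ⊗[E] V)
          = (A (g * c⁻¹) : V ⊗[E] V →ₗ[E] V ⊗[E] V) * (A c : V ⊗[E] V →ₗ[E] V ⊗[E] V) := by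
        rw [← Units.val_mul, ← map_mul, ← e]
      have h3 : (η g : E) = (η (g * c⁻¹) : E) * (η c : E) := by
        rw [← Units.val_mul, ← map_mul, ← e]
      rw [h2, h3, Module.End.mul_apply, Module.End.mul_apply]
      refine h1.trans ?_
      ring
  refine ⟨Φ.symm, fun g f => ?_⟩
  obtain ⟨w, rfl⟩ := Φ.surjective f
  rw [LinearEquiv.symm_apply_eq, LinearEquiv.symm_apply_apply]
  refine LinearMap.ext fun v => ?_
  rw [hAd, map_smul, LinearMap.smul_apply, smul_eq_mul]
  have h4 := hinv g w
    ((((A g)⁻¹ : (V ⊗[E] V →ₗ[E] V ⊗[E] V)ˣ) : V ⊗[E] V →ₗ[E] V ⊗[E] V) v)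
  rw [← Module.End.mul_apply (A g : V ⊗[E] V →ₗ[E] V ⊗[E] V), Units.mul_inv,
    Module.End.one_apply] at h4
  rw [h4, ← mul_assoc, ← Units.val_pow_eq_pow_val, ← Units.val_mul, ← mul_pow]
  simp
end

section
/- Let q > 2 be a prime, L a finite extension of ℚ_q with ring of integers O_L, uniformizer ϖ and residue field 𝔽 = O_L/(ϖ). Let Γ be a group and, for i = 1, 2, let ρᵢ : Γ → GL₄(O_L) be representations, Ψᵢ : Γ → O_Lˣ homomorphisms, and Bᵢ ∈ GL₄(O_L) matrices with (ρᵢ(g)⁻¹)^T = Bᵢ·ρᵢ(g)·Bᵢ⁻¹·Ψᵢ(g) for all g ∈ Γ. Assume: (a) Ψ₁(g) ≡ Ψ₂(g) mod ϖ for all g; (b) for each i, the 𝔽-subalgebra of M₄(𝔽) generated by the image of the reduction ρ̄ᵢ : Γ → GL₄(𝔽) is all of M₄(𝔽) (residual absolute irreducibility); (c) there is M ∈ GL₄(𝔽) with ρ̄₂(g) = M·ρ̄₁(g)·M⁻¹ for all g; (d) the reduction B̄₁ satisfies B̄₁^T = −B̄₁ (ρ̄₁ preserves a nondegenerate symplectic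 form). Then B₁^T = −B₁ and B₂^T = −B₂; in particular ρ̄₂ preserves a nondegenerate symplectic form over 𝔽, and each ρᵢ preserves a nondegenerate alternating O_L-bilinear form up to the similitude character Ψᵢ⁻¹. -/
open Matrix MatrixGroups IsLocalRing

/-- Matrices over a local ring whose reductions generate the full matrix algebra generate it. -/
lemma adjoin_lift_top {O Γ : Type*} [CommRing O] [IsLocalRing O]
    (A : Γ → Matrix (Fin 4) (Fin 4) O)
    (h : Algebra.adjoin (ResidueField O) (Set.range fun g => (A g).map (residue O)) = ⊤) :
    Algebra.adjoin O (Set.range A) = ⊤ := by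
  have key : ∀ Y : Matrix (Fin 4) (Fin 4) (ResidueField O),
      ∃ X ∈ Algebra.adjoin O (Set.range A), X.map (residue O) = Y := by
    intro Y
    have hY : Y ∈ Algebra.adjoin (ResidueField O)
        (Set.range fun g => (A g).map (residue O)) := by rw [h]; trivial
    induction hY using Algebra.adjoin_induction with
    | mem x hx =>
      obtain ⟨g, rfl⟩ := hx
      exact ⟨A g, Algebra.subset_adjoin ⟨g, rfl⟩, rfl⟩
    | algebraMap r =>
      obtain ⟨s, rfl⟩ := residue_surjective r
      refine ⟨algebraMap O _ s, Subalgebra.algebraMap_mem _ _, ?_⟩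
      ext i j
      simp [Matrix.algebraMap_matrix_apply]
      split_ifs <;> simp
    | add x y _ _ hx hy =>
      obtain ⟨a, ha, rfl⟩ := hx
      obtain ⟨b, hb, rfl⟩ := hy
      exact ⟨a + b, add_mem ha hb, by ext i j; simp⟩
    | mul x y _ _ hx hy =>
      obtain ⟨a, ha, rfl⟩ := hx
      obtain ⟨b, hb, rfl⟩ := hy
      exact ⟨a * b, mul_mem ha hb, by rw [Matrix.map_mul]⟩
  rw [← Algebra.toSubmodule_eq_top, eq_top_iff]
  refine Submodule.le_of_le_smul_of_le_jacobson_bot (I := maximalIdeal O)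
    Module.Finite.fg_top (IsLocalRing.maximalIdeal_le_jacobson _) ?_
  intro X _
  obtain ⟨X', hX', hr⟩ := key (X.map (residue O))
  have hd : X - X' ∈ maximalIdeal O • (⊤ : Submodule O (Matrix (Fin 4) (Fin 4) O)) := by
    rw [Matrix.matrix_eq_sum_single (X - X')]
    refine Submodule.sum_mem _ fun i _ => Submodule.sum_mem _ fun j _ => ?_
    have e : Matrix.single i j ((X - X') i j)
        = ((X - X') i j) • Matrix.single i j (1 : O) := by simp
    rw [e]
    refine Submodule.smul_mem_smul ?_ trivial
    rw [← residue_eq_zero_iff]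
    have := congrFun (congrFun hr i) j
    simp only [Matrix.map_apply] at this
    simp [this]
  have : X = X' + (X - X') := by abel
  rw [this]
  exact Submodule.add_mem_sup hX' hd

/-- Schur: two forms with the same similitude character are proportional. -/
lemma forms_proportional {R Γ : Type*} [CommRing R]
    (A A' : Γ → Matrix (Fin 4) (Fin 4) R) (hA : ∀ g, A g * A' g = 1)
    (h : Algebra.adjoin R (Set.range A) = ⊤) (u : Γ → Rˣ)
    (B B' N : Matrix (Fin 4) (Fin 4) R) (hB : B * B' = 1)
    (h1 : ∀ g, (A g)ᵀ * B * A g = (u g : R) • B)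
    (h2 : ∀ g, (A g)ᵀ * N * A g = (u g : R) • N) : ∃ c : R, N = c • B := by
  have hB' : B' * B = 1 := mul_eq_one_comm.mp hB
  have hA' : ∀ g, A' g * A g = 1 := fun g => mul_eq_one_comm.mp (hA g)
  have hT : ∀ g, (A g)ᵀ = (u g : R) • (B * A' g * B') := by
    intro g
    calc (A g)ᵀ = ((A g)ᵀ * B * A g) * A' g * B' := by
          simp only [Matrix.mul_assoc]
          rw [← Matrix.mul_assoc (A g), hA, Matrix.one_mul, hB, Matrix.mul_one]
      _ = _ := by rw [h1]; simp [Matrix.mul_assoc]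
  have hcomm : ∀ g, A g * (B' * N) = (B' * N) * A g := by
    intro g
    have h3 : B * A' g * B' * N * A g = N := by
      have := h2 g
      rw [hT g] at this
      simp only [Matrix.smul_mul] at this
      have h4 := congrArg (fun X => ((u g)⁻¹ : Rˣ) • X) this
      simpa [Units.smul_def, smul_smul] using h4
    calc A g * (B' * N) = A g * (B' * (B * A' g * B' * N * A g)) := by rw [h3]
      _ = A g * ((B' * B) * (A' g * (B' * (N * A g)))) := by simp only [Matrix.mul_assoc]
      _ = (A g * A' g) * (B' * (N * A g)) := by rw [hB', Matrix.one_mul, Matrix.mul_assoc]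
      _ = _ := by rw [hA, Matrix.one_mul, Matrix.mul_assoc]
  have hall : ∀ X : Matrix (Fin 4) (Fin 4) R, X * (B' * N) = (B' * N) * X := by
    intro X
    have hX : X ∈ Algebra.adjoin R (Set.range A) := by rw [h]; trivial
    induction hX using Algebra.adjoin_induction with
    | mem x hx => obtain ⟨g, rfl⟩ := hx; exact hcomm g
    | algebraMap r => exact Algebra.commutes r _
    | add x y _ _ hx hy => rw [add_mul, mul_add, hx, hy]
    | mul x y _ _ hx hy => rw [mul_assoc, hy, ← mul_assoc, hx, mul_assoc]
  obtain ⟨c, hc⟩ := (Matrix.mem_range_scalar_iff_commute_single' (M := B' * N)).mpr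
    fun i j => hall _
  refine ⟨c, ?_⟩
  calc N = B * (B' * N) := by rw [← Matrix.mul_assoc, hB, Matrix.one_mul]
    _ = _ := by rw [← hc]; ext i j; simp [Matrix.scalar_apply, mul_comm]

lemma form_of_dual {O : Type*} [CommRing O] (r B : GL (Fin 4) O) (u : Oˣ)
    (h : ((r⁻¹ : GL (Fin 4) O) : Matrix (Fin 4) (Fin 4) O)ᵀ
      = (u : O) • ((B : Matrix (Fin 4) (Fin 4) O) * (r : Matrix (Fin 4) (Fin 4) O) *
          ((B⁻¹ : GL (Fin 4) O) : Matrix (Fin 4) (Fin 4) O))) :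
    (r : Matrix (Fin 4) (Fin 4) O)ᵀ * (B : Matrix (Fin 4) (Fin 4) O) *
        (r : Matrix (Fin 4) (Fin 4) O)
      = ((u⁻¹ : Oˣ) : O) • (B : Matrix (Fin 4) (Fin 4) O) := by
  have h1 : (r : Matrix (Fin 4) (Fin 4) O)ᵀ *
      ((r⁻¹ : GL (Fin 4) O) : Matrix (Fin 4) (Fin 4) O)ᵀ = 1 := by
    rw [← Matrix.transpose_mul, Units.inv_mul, Matrix.transpose_one]
  have h2 : (B : Matrix (Fin 4) (Fin 4) O) * (r : Matrix (Fin 4) (Fin 4) O)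
      = ((u⁻¹ : Oˣ) : O) • (((r⁻¹ : GL (Fin 4) O) : Matrix (Fin 4) (Fin 4) O)ᵀ * B) := by
    rw [h, Matrix.smul_mul, smul_smul, Units.inv_mul, one_smul, Matrix.mul_assoc,
      Units.inv_mul, Matrix.mul_one]
  rw [Matrix.mul_assoc, h2, Matrix.mul_smul, ← Matrix.mul_assoc, h1, Matrix.one_mul]

lemma reduce_form {O : Type*} [CommRing O] [IsLocalRing O]
    (r B : Matrix (Fin 4) (Fin 4) O) (u : O) (h : rᵀ * B * r = u • B) :
    (r.map (residue O))ᵀ * B.map (residue O) * r.map (residue O)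
      = residue O u • B.map (residue O) := by
  have := congrArg (fun X => X.map (residue O)) h
  simp only [Matrix.map_mul] at this
  rw [← Matrix.transpose_map, this]
  ext i j; simp

/-- A form that is residually alternating is alternating. -/
lemma alt_lift {O Γ : Type*} [CommRing O] [IsDomain O] [IsLocalRing O]
    (h2 : (2 : ResidueField O) ≠ 0)
    (ρ : Γ → GL (Fin 4) O) (u : Γ → Oˣ) (B : GL (Fin 4) O)
    (hirr : Algebra.adjoin (ResidueField O)
      (Set.range fun g => ((ρ g : Matrix (Fin 4) (Fin 4) O)).map (residue O)) = ⊤)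
    (hf : ∀ g, (ρ g : Matrix (Fin 4) (Fin 4) O)ᵀ * (B : Matrix (Fin 4) (Fin 4) O) *
        (ρ g : Matrix (Fin 4) (Fin 4) O) = (u g : O) • (B : Matrix (Fin 4) (Fin 4) O))
    (halt : (((B : Matrix (Fin 4) (Fin 4) O)).map (residue O))ᵀ
      = -(((B : Matrix (Fin 4) (Fin 4) O)).map (residue O))) :
    (B : Matrix (Fin 4) (Fin 4) O)ᵀ = -(B : Matrix (Fin 4) (Fin 4) O) := by
  obtain ⟨c, hc⟩ := forms_proportional
    (fun g => (ρ g : Matrix (Fin 4) (Fin 4) O))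
    (fun g => (((ρ g)⁻¹ : GL (Fin 4) O) : Matrix (Fin 4) (Fin 4) O))
    (fun g => Units.mul_inv _) (adjoin_lift_top _ hirr) u B
    ((B⁻¹ : GL (Fin 4) O) : Matrix (Fin 4) (Fin 4) O) (B : Matrix (Fin 4) (Fin 4) O)ᵀ
    (Units.mul_inv _) hf (fun g => by
      have := congrArg Matrix.transpose (hf g)
      simpa [Matrix.transpose_mul, Matrix.mul_assoc] using this)
  have hbne : (B : Matrix (Fin 4) (Fin 4) O).map (residue O) ≠ 0 := by
    intro h0
    have h1 := congrArg (fun X => X.map (residue O)) (Units.mul_inv B)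
    simp only [Matrix.map_mul, h0, Matrix.zero_mul] at h1
    have := congrFun (congrFun h1 0) 0
    simp at this
  obtain ⟨i, j, hij⟩ : ∃ i j, residue O ((B : Matrix (Fin 4) (Fin 4) O) i j) ≠ 0 := by
    by_contra! hcon
    exact hbne (by ext i j; exact hcon i j)
  have hBne : (B : Matrix (Fin 4) (Fin 4) O) i j ≠ 0 := fun h => hij (by rw [h, map_zero])
  have e1 := congrFun (congrFun hc i) j
  have e2 := congrFun (congrFun hc j) i
  have e3 := congrFun (congrFun halt i) j
  simp only [Matrix.transpose_apply, Matrix.smul_apply, smul_eq_mul, Matrix.map_apply,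
    Matrix.neg_apply] at e1 e2 e3
  have hcc : c * c = 1 := by
    apply mul_right_cancel₀ hBne
    rw [one_mul, mul_assoc, ← e1, ← e2]
  rcases mul_self_eq_one_iff.mp hcc with rfl | rfl
  · exfalso
    rw [one_mul] at e1
    rw [e1] at e3
    have : (2 : ResidueField O) * residue O ((B : Matrix (Fin 4) (Fin 4) O) i j) = 0 := by
      linear_combination e3
    exact (mul_ne_zero h2 hij) this
  · rw [hc, neg_one_smul]

/-- **Lifting symplecticity of polarizations along congruences (Lemma on signs).**
Let `q > 2` be a prime, `L` a finite extension of `ℚ_q` with ring of integers `O`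
(the integral closure of `ℤ_q` in `L`), uniformizer `ϖ` and residue field `𝔽`.
Let `ρᵢ : Γ → GL₄(O)` be representations polarized by `Bᵢ ∈ GL₄(O)` with similitude
characters `Ψᵢ`, such that `Ψ₁ ≡ Ψ₂ mod ϖ`, the reductions `ρ̄ᵢ` are absolutely
irreducible and conjugate, and `ρ̄₁` preserves a nondegenerate symplectic form
(`B̄₁ᵀ = -B̄₁`).  Then `B₁ᵀ = -B₁` and `B₂ᵀ = -B₂`; in particular `ρ̄₂` preserves a
nondegenerate symplectic form over `𝔽` and each `ρᵢ` preserves a nondegenerate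
alternating `O`-bilinear form up to the similitude character `Ψᵢ⁻¹`. -/
theorem symplectic_of_residually_symplectic
    (q : ℕ) [Fact q.Prime] (hq : 2 < q)
    {L : Type*} [Field L] [Algebra ℚ_[q] L] [FiniteDimensional ℚ_[q] L]
    {O : Type*} [CommRing O] [IsDomain O] [IsLocalRing O]
    [Algebra O L] [Algebra ℤ_[q] O] [Algebra ℤ_[q] L] [IsScalarTower ℤ_[q] O L]
    (hO : IsIntegralClosure O ℤ_[q] L)
    (ϖ : O) (hϖ : maximalIdeal O = Ideal.span {ϖ})
    {Γ : Type*} [Group Γ]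
    (ρ₁ ρ₂ : Γ →* GL (Fin 4) O) (Ψ₁ Ψ₂ : Γ →* Oˣ) (B₁ B₂ : GL (Fin 4) O)
    (hB₁ : ∀ g : Γ, (((ρ₁ g)⁻¹ : GL (Fin 4) O) : Matrix (Fin 4) (Fin 4) O)ᵀ
      = (Ψ₁ g : O) • ((B₁ : Matrix (Fin 4) (Fin 4) O) *
          (ρ₁ g : Matrix (Fin 4) (Fin 4) O) *
          ((B₁⁻¹ : GL (Fin 4) O) : Matrix (Fin 4) (Fin 4) O)))
    (hB₂ : ∀ g : Γ, (((ρ₂ g)⁻¹ : GL (Fin 4) O) : Matrix (Fin 4) (Fin 4) O)ᵀ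
      = (Ψ₂ g : O) • ((B₂ : Matrix (Fin 4) (Fin 4) O) *
          (ρ₂ g : Matrix (Fin 4) (Fin 4) O) *
          ((B₂⁻¹ : GL (Fin 4) O) : Matrix (Fin 4) (Fin 4) O)))
    -- (a) `Ψ₁ ≡ Ψ₂ mod ϖ`
    (hΨ : ∀ g : Γ, residue O (Ψ₁ g : O) = residue O (Ψ₂ g : O))
    -- (b) residual absolute irreducibility of `ρ̄₁` and `ρ̄₂`
    (hirr₁ : Algebra.adjoin (ResidueField O)
      (Set.range fun g => ((ρ₁ g : Matrix (Fin 4) (Fin 4) O)).map (residue O)) = ⊤)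
    (hirr₂ : Algebra.adjoin (ResidueField O)
      (Set.range fun g => ((ρ₂ g : Matrix (Fin 4) (Fin 4) O)).map (residue O)) = ⊤)
    -- (c) `ρ̄₂ = M ρ̄₁ M⁻¹`
    (M : GL (Fin 4) (ResidueField O))
    (hconj : ∀ g : Γ, ((ρ₂ g : Matrix (Fin 4) (Fin 4) O)).map (residue O)
      = (M : Matrix (Fin 4) (Fin 4) (ResidueField O)) *
          ((ρ₁ g : Matrix (Fin 4) (Fin 4) O)).map (residue O) *
          ((M⁻¹ : GL (Fin 4) (ResidueField O)) : Matrix (Fin 4) (Fin 4) (ResidueField O)))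
    -- (d) `B̄₁` is antisymmetric
    (hB₁alt : (((B₁ : Matrix (Fin 4) (Fin 4) O)).map (residue O))ᵀ
      = -(((B₁ : Matrix (Fin 4) (Fin 4) O)).map (residue O))) :
    (B₁ : Matrix (Fin 4) (Fin 4) O)ᵀ = -(B₁ : Matrix (Fin 4) (Fin 4) O) ∧
    (B₂ : Matrix (Fin 4) (Fin 4) O)ᵀ = -(B₂ : Matrix (Fin 4) (Fin 4) O) ∧
    -- in particular: `ρ̄₂` preserves a nondegenerate symplectic form over `𝔽` ...
    ((((B₂ : Matrix (Fin 4) (Fin 4) O)).map (residue O))ᵀ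
        = -(((B₂ : Matrix (Fin 4) (Fin 4) O)).map (residue O)) ∧
      IsUnit (((B₂ : Matrix (Fin 4) (Fin 4) O)).map (residue O)) ∧
      (∀ g : Γ, (((ρ₂ g : Matrix (Fin 4) (Fin 4) O)).map (residue O))ᵀ *
          (((B₂ : Matrix (Fin 4) (Fin 4) O)).map (residue O)) *
          (((ρ₂ g : Matrix (Fin 4) (Fin 4) O)).map (residue O))
        = residue O (((Ψ₂ g)⁻¹ : Oˣ) : O) •
            (((B₂ : Matrix (Fin 4) (Fin 4) O)).map (residue O)))) ∧
    -- ... and each `ρᵢ` preserves a nondegenerate alternating form up to `Ψᵢ⁻¹`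
    (∀ g : Γ, (ρ₁ g : Matrix (Fin 4) (Fin 4) O)ᵀ * (B₁ : Matrix (Fin 4) (Fin 4) O) *
        (ρ₁ g : Matrix (Fin 4) (Fin 4) O)
      = (((Ψ₁ g)⁻¹ : Oˣ) : O) • (B₁ : Matrix (Fin 4) (Fin 4) O)) ∧
    (∀ g : Γ, (ρ₂ g : Matrix (Fin 4) (Fin 4) O)ᵀ * (B₂ : Matrix (Fin 4) (Fin 4) O) *
        (ρ₂ g : Matrix (Fin 4) (Fin 4) O)
      = (((Ψ₂ g)⁻¹ : Oˣ) : O) • (B₂ : Matrix (Fin 4) (Fin 4) O)) := by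
  have h2 : (2 : ResidueField O) ≠ 0 := by
    have hint : Algebra.IsIntegral ℤ_[q] O := IsIntegralClosure.isIntegral_algebra ℤ_[q] L
    have hmax : ((maximalIdeal O).comap (algebraMap ℤ_[q] O)).IsMaximal :=
      Ideal.isMaximal_comap_of_isIntegral_of_isMaximal _
    have hqm : (q : ℤ_[q]) ∈ (maximalIdeal O).comap (algebraMap ℤ_[q] O) := by
      rw [IsLocalRing.eq_maximalIdeal hmax, PadicInt.maximalIdeal_eq_span_p]
      exact Ideal.mem_span_singleton_self _
    have hq0 : ((q : ℕ) : ResidueField O) = 0 := by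
      rw [Ideal.mem_comap, map_natCast, ← residue_eq_zero_iff, map_natCast] at hqm
      exact hqm
    intro h20
    obtain ⟨k, hk⟩ := (Fact.out : q.Prime).odd_of_ne_two (by omega)
    rw [hk] at hq0
    push_cast at hq0
    rw [h20] at hq0
    simp at hq0
  have f₁ := fun g => form_of_dual (ρ₁ g) B₁ (Ψ₁ g) (hB₁ g)
  have f₂ := fun g => form_of_dual (ρ₂ g) B₂ (Ψ₂ g) (hB₂ g)
  have r₁ := fun g => reduce_form _ _ _ (f₁ g)
  have r₂ := fun g => reduce_form _ _ _ (f₂ g)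
  have hinvmap : ∀ X : GL (Fin 4) O, (X : Matrix (Fin 4) (Fin 4) O).map (residue O) *
      ((X⁻¹ : GL (Fin 4) O) : Matrix (Fin 4) (Fin 4) O).map (residue O) = 1 := by
    intro X
    rw [← Matrix.map_mul, Units.mul_inv, Matrix.map_one _ (map_zero _) (map_one _)]
  have hu : ∀ g, residue O (((Ψ₁ g)⁻¹ : Oˣ) : O) = residue O (((Ψ₂ g)⁻¹ : Oˣ) : O) := by
    intro g
    have e : Units.map (residue O : O →* ResidueField O) (Ψ₁ g)
        = Units.map (residue O : O →* ResidueField O) (Ψ₂ g) := Units.ext (hΨ g)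
    have := congrArg (fun x : (ResidueField O)ˣ => ((x⁻¹ : (ResidueField O)ˣ) : ResidueField O)) e
    simpa only [← map_inv, Units.coe_map, MonoidHom.coe_coe] using this
  have hMM : ((M⁻¹ : GL (Fin 4) (ResidueField O)) : Matrix (Fin 4) (Fin 4) (ResidueField O)) *
      (M : Matrix (Fin 4) (Fin 4) (ResidueField O)) = 1 := Units.inv_mul _
  generalize hM' : ((M⁻¹ : GL (Fin 4) (ResidueField O)) :
    Matrix (Fin 4) (Fin 4) (ResidueField O)) = M' at hconj hMM
  generalize (M : Matrix (Fin 4) (Fin 4) (ResidueField O)) = m at hconj hMM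
  have hMMT : mᵀ * M'ᵀ = 1 := by rw [← Matrix.transpose_mul, hMM, Matrix.transpose_one]
  obtain ⟨c, hc⟩ := forms_proportional
    (fun g => (ρ₂ g : Matrix (Fin 4) (Fin 4) O).map (residue O))
    (fun g => (((ρ₂ g)⁻¹ : GL (Fin 4) O) : Matrix (Fin 4) (Fin 4) O).map (residue O))
    (fun g => hinvmap _) hirr₂
    (fun g => Units.map (residue O : O →* ResidueField O) (Ψ₂ g)⁻¹)
    ((B₂ : Matrix (Fin 4) (Fin 4) O).map (residue O))
    (((B₂⁻¹ : GL (Fin 4) O) : Matrix (Fin 4) (Fin 4) O).map (residue O))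
    (M'ᵀ * (B₁ : Matrix (Fin 4) (Fin 4) O).map (residue O) * M')
    (hinvmap _) r₂ (fun g => by
      have e := r₁ g
      rw [hu] at e
      simp only [Units.coe_map, MonoidHom.coe_coe]
      rw [hconj, ← Matrix.smul_mul, ← Matrix.mul_smul, ← e]
      simp only [Matrix.transpose_mul, Matrix.mul_assoc]
      rw [← Matrix.mul_assoc mᵀ, hMMT, Matrix.one_mul, ← Matrix.mul_assoc M' m, hMM,
        Matrix.one_mul])
  have hcne : c ≠ 0 := by
    rintro rfl
    rw [zero_smul] at hc
    have hz : (B₁ : Matrix (Fin 4) (Fin 4) O).map (residue O) = 0 := by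
      calc _ = (mᵀ * M'ᵀ) * (B₁ : Matrix (Fin 4) (Fin 4) O).map (residue O) * (M' * m) := by
            rw [hMM, hMMT, Matrix.one_mul, Matrix.mul_one]
        _ = mᵀ * (M'ᵀ * (B₁ : Matrix (Fin 4) (Fin 4) O).map (residue O) * M') * m := by
            simp only [Matrix.mul_assoc]
        _ = 0 := by rw [hc]; simp
    have := hinvmap B₁
    rw [hz, Matrix.zero_mul] at this
    have := congrFun (congrFun this 0) 0
    simp at this
  have hB₂alt : (((B₂ : Matrix (Fin 4) (Fin 4) O)).map (residue O))ᵀ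
      = -(((B₂ : Matrix (Fin 4) (Fin 4) O)).map (residue O)) := by
    have e := congrArg Matrix.transpose hc
    simp only [Matrix.transpose_mul, Matrix.transpose_transpose, Matrix.transpose_smul] at e
    rw [hB₁alt, Matrix.neg_mul, Matrix.mul_neg, ← Matrix.mul_assoc, hc] at e
    apply smul_right_injective _ hcne
    simp only [smul_neg]
    exact e.symm
  exact ⟨alt_lift h2 ρ₁ (fun g => (Ψ₁ g)⁻¹) B₁ hirr₁ f₁ hB₁alt,
    alt_lift h2 ρ₂ (fun g => (Ψ₂ g)⁻¹) B₂ hirr₂ f₂ hB₂alt,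
    ⟨hB₂alt, IsUnit.of_mul_eq_one _ (hinvmap B₂), r₂⟩, f₁, f₂⟩
end
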